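/- arXiv:1706.06893 — 2 statements merged into one kernel-verified Lean document; each statement's English description precedes it below -/
import Mathlib

section
/- Let p ≥ 2, ε > 0, β > 0, γ > 0, λ₁ > 0 with β ≤ ε λ₁ / p, and let λ > λ₁. Let f : [0,∞) → ℝ be continuous with f(u) ≥ λ u^{p−1} for all u > 0, F(u) := ∫₀^u f(s) ds, and suppose (p+ε) F(u) ≤ u f(u) + β u^p + γ for all u > 0 (condition (C_p)). Then there exist constants μ > 0 and m > 1 such that f(u) ≥ μ u^{p−1+ε} for all u ≥ m. -/
open Real Set

/-- If `u K'(u) ≥ q K(u)` on the positive half-line, then `K(u) / u ^ q` is nondecreasing there. -/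
theorem monotoneOn_mul_rpow_neg {K K' : ℝ → ℝ} {q : ℝ}
    (hK : ∀ u, 0 < u → HasDerivAt K (K' u) u) (h : ∀ u, 0 < u → q * K u ≤ u * K' u) :
    MonotoneOn (fun u => K u * u ^ (-q)) (Set.Ioi 0) := by
  have hd : ∀ u : ℝ, 0 < u → HasDerivAt (fun u => K u * u ^ (-q))
      (K' u * u ^ (-q) + K u * (-q * u ^ (-q - 1))) u := fun u hu =>
    (hK u hu).mul (Real.hasDerivAt_rpow_const (Or.inl hu.ne'))
  refine monotoneOn_of_deriv_nonneg (convex_Ioi 0)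
    (fun u hu => (hd u hu).continuousAt.continuousWithinAt) ?_ ?_
  · intro u hu
    rw [interior_Ioi] at hu
    exact (hd u hu).differentiableAt.differentiableWithinAt
  · intro u hu
    rw [interior_Ioi] at hu
    have hu : 0 < u := hu
    have hpow : u ^ (-q) = u * u ^ (-q - 1) := by
      rw [Real.rpow_sub_one hu.ne']; field_simp
    have hfac : K' u * u ^ (-q) + K u * (-q * u ^ (-q - 1))
        = (u * K' u - q * K u) * u ^ (-q - 1) := by
      rw [hpow]; ring
    rw [(hd u hu).deriv, hfac]
    exact mul_nonneg (sub_nonneg.2 (h u hu)) (Real.rpow_nonneg hu.le _)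

/-- A primitive of a function continuous on `[0, ∞)` is differentiable at positive points. -/
theorem hasDerivAt_integral_of_continuousOn_Ici {f : ℝ → ℝ} (hf : ContinuousOn f (Set.Ici 0))
    {u : ℝ} (hu : 0 < u) : HasDerivAt (fun x => ∫ s in (0:ℝ)..x, f s) (f u) u := by
  have hfu : ContinuousAt f u := hf.continuousAt (Ici_mem_nhds hu)
  refine intervalIntegral.integral_hasDerivAt_right ?_ ?_ hfu
  · exact (hf.mono (Set.uIcc_of_le hu.le ▸ Set.Icc_subset_Ici_self)).intervalIntegrable
  · exact (hf.mono Set.Ioi_subset_Ici_self).stronglyMeasurableAtFilter isOpen_Ioi u hu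

/-- Integrating the lower bound `lam * s ^ (p - 1) ≤ f s`. -/
theorem div_mul_rpow_le_integral {f : ℝ → ℝ} (hf : ContinuousOn f (Set.Ici 0)) {p lam : ℝ}
    (hp : 1 ≤ p) (hflb : ∀ u : ℝ, 0 < u → lam * u ^ (p - 1) ≤ f u) {u : ℝ} (hu : 0 < u) :
    lam / p * u ^ p ≤ ∫ s in (0:ℝ)..u, f s := by
  have hint : ∫ s in (0:ℝ)..u, lam * s ^ (p - 1) = lam / p * u ^ p := by
    rw [intervalIntegral.integral_const_mul, integral_rpow (Or.inl (by linarith)),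
      sub_add_cancel, Real.zero_rpow (by linarith)]
    ring
  rw [← hint]
  refine intervalIntegral.integral_mono_on_of_le_Ioo hu.le ?_ ?_ fun s hs => hflb s hs.1
  · exact (intervalIntegral.intervalIntegrable_rpow' (by linarith)).const_mul _
  · exact (hf.mono (Set.uIcc_of_le hu.le ▸ Set.Icc_subset_Ici_self)).intervalIntegrable

/-- First assertion of Lemma 4.1: if `f(u) ≥ λ u^{p-1}` with `λ > λ₁` and `f` satisfies
condition `(C_p)`, then `f(u) ≥ μ u^{p-1+ε}` for all `u ≥ m`, for some `μ > 0` and `m > 1`. -/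
theorem condition_Cp_superlinear_growth
    (p ε β γ lam1 lam : ℝ) (hp : 2 ≤ p) (hε : 0 < ε) (hβ : 0 < β) (hγ : 0 < γ)
    (hlam1 : 0 < lam1) (hβle : β ≤ ε * lam1 / p) (hlam : lam1 < lam)
    (f : ℝ → ℝ) (hf : ContinuousOn f (Set.Ici 0))
    (hflb : ∀ u : ℝ, 0 < u → lam * u ^ (p - 1) ≤ f u)
    (F : ℝ → ℝ) (hF : ∀ u : ℝ, F u = ∫ s in (0:ℝ)..u, f s)
    (hCp : ∀ u : ℝ, 0 < u → (p + ε) * F u ≤ u * f u + β * u ^ p + γ) :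
    ∃ μ > (0:ℝ), ∃ m > (1:ℝ), ∀ u : ℝ, m ≤ u → μ * u ^ (p - 1 + ε) ≤ f u := by
  have hp0 : 0 < p := by linarith
  have hq : 0 < p + ε := by linarith
  set K : ℝ → ℝ := fun u => F u - β / ε * u ^ p - γ / (p + ε) with hKdef
  have hKd : ∀ u, 0 < u → HasDerivAt K (f u - β / ε * (p * u ^ (p - 1))) u := by
    intro u hu
    have hFd : HasDerivAt F (f u) u := by
      rw [funext hF]
      exact hasDerivAt_integral_of_continuousOn_Ici hf hu
    exact (hFd.sub ((Real.hasDerivAt_rpow_const (Or.inl hu.ne')).const_mul _)).sub_const _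
  have hid : ∀ u, 0 < u → u * (f u - β / ε * (p * u ^ (p - 1))) - (p + ε) * K u
      = u * f u + β * u ^ p + γ - (p + ε) * F u := by
    intro u hu
    have hpow : u ^ p = u * u ^ (p - 1) := by
      rw [Real.rpow_sub_one hu.ne']; field_simp
    simp only [hKdef, hpow]
    field_simp
    ring
  have hmono := monotoneOn_mul_rpow_neg (q := p + ε) hKd fun u hu => by
    linarith [hid u hu, hCp u hu]
  have hgap : 0 < lam / p - β / ε := by
    have h1 : β / ε ≤ lam1 / p := by
      rw [div_le_iff₀ hε]
      exact hβle.trans_eq (by ring)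
    have h2 : lam1 / p < lam / p := by gcongr
    linarith
  obtain ⟨m, hm1, hm⟩ : ∃ m > (1:ℝ), γ / (p + ε) < (lam / p - β / ε) * m ^ p :=
    ((Filter.eventually_gt_atTop 1).and
      (((tendsto_rpow_atTop hp0).const_mul_atTop hgap).eventually_gt_atTop _)).exists
  have hm0 : 0 < m := by linarith
  have hKm : 0 < K m := by
    have := div_mul_rpow_le_integral hf (by linarith) hflb hm0
    rw [← hF] at this
    simp only [hKdef]
    linarith
  have hc : 0 < K m * m ^ (-(p + ε)) := mul_pos hKm (Real.rpow_pos_of_pos hm0 _)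
  refine ⟨(p + ε) * (K m * m ^ (-(p + ε))), mul_pos hq hc, m, hm1, fun u hmu => ?_⟩
  have hu : 0 < u := by linarith
  have hKu : K m * m ^ (-(p + ε)) * u ^ (p + ε) ≤ K u := by
    have : K m * m ^ (-(p + ε)) ≤ K u * u ^ (-(p + ε)) := hmono hm0 hu hmu
    rwa [Real.rpow_neg hu.le, ← div_eq_mul_inv, le_div_iff₀ (Real.rpow_pos_of_pos hu _)] at this
  have hpow : u ^ (p + ε) = u * u ^ (p - 1 + ε) := by
    rw [show p - 1 + ε = p + ε - 1 by ring, Real.rpow_sub_one hu.ne']; field_simp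
  have hpos : 0 ≤ β / ε * (p * u ^ (p - 1)) := by positivity
  rw [hpow] at hKu
  refine le_of_mul_le_mul_left ?_ hu
  nlinarith [hid u hu, hCp u hu, mul_le_mul_of_nonneg_left hKu hq.le, mul_nonneg hu.le hpos]
end

section
/- Let p ≥ 2, ε > 0, β > 0, γ > 0, λ₁ > 0 with β ≤ ε λ₁ / p, and let λ > λ₁. Let f : [0,∞) → ℝ be continuous with f(u) ≥ λ u^{p−1} for all u > 0, F(u) := ∫₀^u f(s) ds, and suppose (p+ε) F(u) ≤ u f(u) + β u^p + γ for all u > 0 (condition (C_p)). Then with ε₂ := ε (1 − λ₁/λ) > 0 one has (p+ε₂) F(u) ≤ u f(u) + γ for all u > 0; that is, f also satisfies condition (B_p). Consequently, for such f, conditions (B_p) and (C_p) are equivalent. -/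
open Real Set

/-- Integrating the lower bound `c * s ^ (p - 1) ≤ f s` over `[0, u]`. -/
theorem mul_rpow_div_le_integral_of_le {p c u : ℝ} (hp : 1 ≤ p) (hu : 0 ≤ u) {f : ℝ → ℝ}
    (hf : ContinuousOn f (Set.Ici 0)) (hflb : ∀ s : ℝ, 0 < s → c * s ^ (p - 1) ≤ f s) :
    c * (u ^ p / p) ≤ ∫ s in (0 : ℝ)..u, f s := by
  have hpow : ∫ s in (0 : ℝ)..u, c * s ^ (p - 1) = c * (u ^ p / p) := by
    rw [intervalIntegral.integral_const_mul, integral_rpow (Or.inl (by linarith)),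
      sub_add_cancel, Real.zero_rpow (by linarith), sub_zero]
  rw [← hpow]
  refine intervalIntegral.integral_mono_on_of_le_Ioo hu ?_ ?_ fun s hs => hflb s hs.1
  · exact (intervalIntegral.intervalIntegrable_rpow' (by linarith)).const_mul c
  · refine ContinuousOn.intervalIntegrable (hf.mono ?_)
    rw [Set.uIcc_of_le hu]
    exact Set.Icc_subset_Ici_self

/-- The lower bound `lam * (t / p) ≤ F` absorbs the term `β * t` at the cost of shrinking `ε`. -/
theorem add_mul_le_of_add_mul_le_add {p ε β lam1 lam t F R : ℝ} (hε : 0 < ε)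
    (hlam1 : 0 < lam1) (hlam : lam1 < lam) (hβ : β ≤ ε * lam1 / p) (ht : 0 ≤ t)
    (hF : lam * (t / p) ≤ F) (h : (p + ε) * F ≤ R + β * t) :
    (p + ε * (1 - lam1 / lam)) * F ≤ R := by
  have hlam0 : 0 < lam := hlam1.trans hlam
  have h1 : β * t ≤ ε * lam1 / p * t := mul_le_mul_of_nonneg_right hβ ht
  have h2 : ε * (lam1 / lam) * (lam * (t / p)) ≤ ε * (lam1 / lam) * F :=
    mul_le_mul_of_nonneg_left hF (by positivity)
  have h3 : ε * (lam1 / lam) * (lam * (t / p)) = ε * lam1 / p * t := by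
    field_simp
  linarith

/-- Second assertion of Lemma 4.1: if `f(u) ≥ λ u^{p-1}` with `λ > λ₁` and `f` satisfies
condition `(C_p)` with constants `ε, β, γ`, then with `ε₂ = ε(1 - λ₁/λ) > 0` one has
`(p+ε₂)F(u) ≤ u f(u) + γ` for all `u > 0`, i.e. `f` satisfies condition `(B_p)`;
consequently, for such `f`, conditions `(B_p)` and `(C_p)` are equivalent. -/
theorem condition_Cp_implies_Bp
    (p ε β γ lam1 lam : ℝ) (hp : 2 ≤ p) (hε : 0 < ε) (hβ : 0 < β) (hγ : 0 < γ)
    (hlam1 : 0 < lam1) (hβle : β ≤ ε * lam1 / p) (hlam : lam1 < lam)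
    (f : ℝ → ℝ) (hf : ContinuousOn f (Set.Ici 0))
    (hflb : ∀ u : ℝ, 0 < u → lam * u ^ (p - 1) ≤ f u)
    (F : ℝ → ℝ) (hF : ∀ u : ℝ, F u = ∫ s in (0:ℝ)..u, f s)
    (hCp : ∀ u : ℝ, 0 < u → (p + ε) * F u ≤ u * f u + β * u ^ p + γ) :
    (0 < ε * (1 - lam1 / lam) ∧
      ∀ u : ℝ, 0 < u → (p + ε * (1 - lam1 / lam)) * F u ≤ u * f u + γ) ∧
    ((∃ ε' > (0:ℝ), ∃ γ' > (0:ℝ),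
        ∀ u : ℝ, 0 < u → (p + ε') * F u ≤ u * f u + γ') ↔
      (∃ ε' > (0:ℝ), ∃ β' > (0:ℝ), ∃ γ' > (0:ℝ), β' ≤ ε' * lam1 / p ∧
        ∀ u : ℝ, 0 < u → (p + ε') * F u ≤ u * f u + β' * u ^ p + γ')) := by
  have hε₂ : ∀ e : ℝ, 0 < e → 0 < e * (1 - lam1 / lam) := fun e he =>
    mul_pos he (sub_pos.2 ((div_lt_one (hlam1.trans hlam)).2 hlam))
  have hFlb : ∀ u : ℝ, 0 < u → lam * (u ^ p / p) ≤ F u := fun u hu => by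
    rw [hF]
    exact mul_rpow_div_le_integral_of_le (by linarith) hu.le hf hflb
  have hBp : ∀ e b c : ℝ, 0 < e → b ≤ e * lam1 / p →
      (∀ u : ℝ, 0 < u → (p + e) * F u ≤ u * f u + b * u ^ p + c) →
      ∀ u : ℝ, 0 < u → (p + e * (1 - lam1 / lam)) * F u ≤ u * f u + c :=
    fun e b c he hb h u hu =>
      add_mul_le_of_add_mul_le_add he hlam1 hlam hb (Real.rpow_nonneg hu.le p) (hFlb u hu)
        (by linarith [h u hu])
  refine ⟨⟨hε₂ ε hε, hBp ε β γ hε hβle hCp⟩, ?_, ?_⟩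
  · rintro ⟨e, he, c, hc, h⟩
    have hb : 0 < e * lam1 / p := div_pos (mul_pos he hlam1) (by linarith)
    refine ⟨e, he, e * lam1 / p, hb, c, hc, le_rfl, fun u hu => ?_⟩
    linarith [h u hu, mul_nonneg hb.le (Real.rpow_nonneg hu.le p)]
  · rintro ⟨e, he, b, -, c, hc, hb, h⟩
    exact ⟨e * (1 - lam1 / lam), hε₂ e he, c, hc, hBp e b c he hb h⟩
end
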